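/- (Theorem 3, irredundant presentation) Let G be the presented group on generators y_1, …, y_m and t_1, …, t_{n−1}, subject to the relations t_k t_l = t_l t_k for |k−l| > 1; t_k t_{k+1} t_k = t_{k+1} t_k t_{k+1} for 1 ≤ k ≤ n−2; y_i t_k = t_k y_i for k ≥ 2 and 1 ≤ i ≤ m; y_i t_1 y_i t_1 = t_1 y_i t_1 y_i for 1 ≤ i ≤ m; and y_i (t_1 y_r t_1⁻¹) = (t_1 y_r t_1⁻¹) y_i for 1 ≤ r < i ≤ m. Then there is a group isomorphism from G onto B_{m,n} sending each y_i to a_{i,m+1} and each t_k to σ_{m+k}. -/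

import Mathlib

open FreeGroup

namespace BraidPaper

/-- Relators for the Artin braid group on generators `σ_1, …, σ_n`
(so this presents the braid group `B_{n+1}`); the generator with index `k : Fin n`
represents `σ_{k+1}`. -/
def braidRels (n : ℕ) : Set (FreeGroup (Fin n)) :=
  {x | ∃ k l : Fin n, ((k : ℕ) + 2 ≤ (l : ℕ) ∨ (l : ℕ) + 2 ≤ (k : ℕ)) ∧
      x = of k * of l * (of k)⁻¹ * (of l)⁻¹} ∪
  {x | ∃ k l : Fin n, (l : ℕ) = (k : ℕ) + 1 ∧
      x = of k * of l * of k * (of l)⁻¹ * (of k)⁻¹ * (of l)⁻¹}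

/-- The braid group with `n` generators `σ_1, …, σ_n`, i.e. the Artin braid group
`B_{n+1}`.  Thus `B_N = BraidGroup (N-1)`. -/
abbrev BraidGroup (n : ℕ) : Type := PresentedGroup (braidRels n)

/-- The generator `σ_k` (1-based) of `BraidGroup n`, for `1 ≤ k ≤ n`. -/
def sgen (n k : ℕ) : BraidGroup n :=
  if h : 1 ≤ k ∧ k ≤ n then PresentedGroup.of ⟨k - 1, by omega⟩ else 1

/-- The descending product `σ_{j-1} σ_{j-2} ⋯ σ_{i+1}`. -/
def dprod (n i j : ℕ) : BraidGroup n :=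
  ((List.range (j - 1 - i)).map fun t => sgen n (j - 1 - t)).prod

/-- The pure braid generator
`a_{ij} = σ_{j-1} σ_{j-2} ⋯ σ_{i+1} σ_i² σ_{i+1}⁻¹ ⋯ σ_{j-2}⁻¹ σ_{j-1}⁻¹`. -/
def agen (n i j : ℕ) : BraidGroup n := dprod n i j * (sgen n i) ^ 2 * (dprod n i j)⁻¹
/-- The generating set of the mixed braid group `B_{m,n} ≤ B_{m+n}`:
the pure generators `a_{ij}` with `1 ≤ i < j`, `m+1 ≤ j ≤ m+n`, together with
the crossings `σ_{m+1}, …, σ_{m+n-1}` among the last `n` strands. -/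
def BmnSet (m n : ℕ) : Set (BraidGroup (m + n - 1)) :=
  {x | ∃ i j : ℕ, 1 ≤ i ∧ i < j ∧ m + 1 ≤ j ∧ j ≤ m + n ∧ x = agen (m + n - 1) i j} ∪
  {x | ∃ k : ℕ, m + 1 ≤ k ∧ k ≤ m + n - 1 ∧ x = sgen (m + n - 1) k}

/-- The mixed braid group `B_{m,n}`, as a subgroup of `B_{m+n}`. -/
def Bmn (m n : ℕ) : Subgroup (BraidGroup (m + n - 1)) := Subgroup.closure (BmnSet m n)
/-- Index set for the irredundant presentation of Theorem 3: generators
`y_1, …, y_m` and `t_1, …, t_{n−1}`. -/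
def IrrIdx (m n : ℕ) : Type :=
  {i : ℕ // 1 ≤ i ∧ i ≤ m} ⊕ {k : ℕ // 1 ≤ k ∧ k ≤ n - 1}

/-- The relators of the irredundant presentation of Theorem 3, as words in the
free group on `IrrIdx m n`. -/
def irrRels (m n : ℕ) : Set (FreeGroup (IrrIdx m n)) :=
  -- t_k t_l = t_l t_k  for |k−l| > 1
  {x | ∃ k l : {k : ℕ // 1 ≤ k ∧ k ≤ n - 1}, (k.1 + 1 < l.1 ∨ l.1 + 1 < k.1) ∧
      x = of (Sum.inr k) * of (Sum.inr l) * (of (Sum.inr k))⁻¹ * (of (Sum.inr l))⁻¹} ∪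
  -- t_k t_{k+1} t_k = t_{k+1} t_k t_{k+1}  for 1 ≤ k ≤ n−2
  {x | ∃ k : ℕ, ∃ _h : 1 ≤ k ∧ k + 1 ≤ n - 1,
      x = of (Sum.inr ⟨k, by omega⟩) * of (Sum.inr ⟨k + 1, by omega⟩) *
            of (Sum.inr ⟨k, by omega⟩) *
          (of (Sum.inr ⟨k + 1, by omega⟩) * of (Sum.inr ⟨k, by omega⟩) *
            of (Sum.inr ⟨k + 1, by omega⟩))⁻¹} ∪
  -- y_i t_k = t_k y_i  for k ≥ 2, 1 ≤ i ≤ m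
  {x | ∃ i k : ℕ, ∃ _h : 1 ≤ i ∧ i ≤ m ∧ 2 ≤ k ∧ k ≤ n - 1,
      x = of (Sum.inl ⟨i, by omega⟩) * of (Sum.inr ⟨k, by omega⟩) *
          (of (Sum.inr ⟨k, by omega⟩) * of (Sum.inl ⟨i, by omega⟩))⁻¹} ∪
  -- y_i t_1 y_i t_1 = t_1 y_i t_1 y_i  for 1 ≤ i ≤ m
  {x | ∃ i : ℕ, ∃ _h : 1 ≤ i ∧ i ≤ m ∧ 1 ≤ n - 1,
      x = of (Sum.inl ⟨i, by omega⟩) * of (Sum.inr ⟨1, by omega⟩) *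
            of (Sum.inl ⟨i, by omega⟩) * of (Sum.inr ⟨1, by omega⟩) *
          (of (Sum.inr ⟨1, by omega⟩) * of (Sum.inl ⟨i, by omega⟩) *
            of (Sum.inr ⟨1, by omega⟩) * of (Sum.inl ⟨i, by omega⟩))⁻¹} ∪
  -- y_i (t_1 y_r t_1⁻¹) = (t_1 y_r t_1⁻¹) y_i  for 1 ≤ r < i ≤ m
  {x | ∃ i r : ℕ, ∃ _h : 1 ≤ r ∧ r < i ∧ i ≤ m ∧ 1 ≤ n - 1,
      x = of (Sum.inl ⟨i, by omega⟩) *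
            (of (Sum.inr ⟨1, by omega⟩) * of (Sum.inl ⟨r, by omega⟩) *
              (of (Sum.inr ⟨1, by omega⟩))⁻¹) *
          (of (Sum.inr ⟨1, by omega⟩) * of (Sum.inl ⟨r, by omega⟩) *
              (of (Sum.inr ⟨1, by omega⟩))⁻¹ * of (Sum.inl ⟨i, by omega⟩))⁻¹}

section

variable {H : Type*} [Group H]

/-- `s 1, …, s n` satisfy Artin's braid relations. -/
structure IsBraidSeq (n : ℕ) (s : ℕ → H) : Prop where
  far : ∀ k l, 1 ≤ k → k + 2 ≤ l → l ≤ n → Commute (s k) (s l)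
  braid : ∀ k, 1 ≤ k → k + 1 ≤ n → s k * s (k + 1) * s k = s (k + 1) * s k * s (k + 1)

/-- The descending product `s (a + l - 1) ⋯ s (a + 1) s a`. -/
def desc (s : ℕ → H) (a : ℕ) : ℕ → H
  | 0 => 1
  | l + 1 => s (a + l) * desc s a l

/-- The pure generator `a_{i, i + 1 + l}` formed from the sequence `s`. -/
def pureGen (s : ℕ → H) (i l : ℕ) : H := desc s (i + 1) l * s i ^ 2 * (desc s (i + 1) l)⁻¹

theorem desc_add (s : ℕ → H) (a l l' : ℕ) :
    desc s a (l + l') = desc s (a + l) l' * desc s a l := by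
  induction l' with
  | zero => simp [desc]
  | succ l' ih => rw [← add_assoc, desc, desc, ih, add_assoc, mul_assoc]

theorem desc_succ' (s : ℕ → H) (a l : ℕ) : desc s a (l + 1) = desc s (a + 1) l * s a := by
  rw [add_comm l 1, desc_add]
  simp [desc]

theorem desc_shift (s : ℕ → H) (m a l : ℕ) :
    desc (fun k => s (m + k)) a l = desc s (m + a) l := by
  induction l with
  | zero => rfl
  | succ l ih => simp only [desc, ih, add_assoc]

theorem map_desc {K : Type*} [Group K] (f : H →* K) (s : ℕ → H) (a l : ℕ) :
    f (desc s a l) = desc (fun k => f (s k)) a l := by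
  induction l with
  | zero => simp [desc]
  | succ l ih => simp [desc, ih]

theorem map_pureGen {K : Type*} [Group K] (f : H →* K) (s : ℕ → H) (i l : ℕ) :
    f (pureGen s i l) = pureGen (fun k => f (s k)) i l := by
  simp [pureGen, map_desc]

theorem desc_congr {s s' : ℕ → H} {a l : ℕ} (h : ∀ k, a ≤ k → k < a + l → s k = s' k) :
    desc s a l = desc s' a l := by
  induction l with
  | zero => rfl
  | succ l ih =>
    rw [desc, desc, h _ (by omega) (by omega), ih fun k h1 h2 => h k h1 (by omega)]

theorem pureGen_congr {s s' : ℕ → H} {i l : ℕ} (h : ∀ k, i ≤ k → k < i + 1 + l → s k = s' k) :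
    pureGen s i l = pureGen s' i l := by
  rw [pureGen, pureGen, h i le_rfl (by omega), desc_congr fun k h1 h2 => h k (by omega) h2]

theorem desc_mem {P : Subgroup H} {s : ℕ → H} {a l : ℕ}
    (h : ∀ k, a ≤ k → k < a + l → s k ∈ P) : desc s a l ∈ P := by
  induction l with
  | zero => exact P.one_mem
  | succ l ih =>
    exact P.mul_mem (h _ (by omega) (by omega)) (ih fun k h1 h2 => h k h1 (by omega))

theorem pureGen_mem {P : Subgroup H} {s : ℕ → H} {i l : ℕ}
    (h : ∀ k, i ≤ k → k < i + 1 + l → s k ∈ P) : pureGen s i l ∈ P :=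
  have hd := desc_mem fun k h1 h2 => h k (by omega : i ≤ k) h2
  P.mul_mem (P.mul_mem hd (P.pow_mem (h i le_rfl (by omega)) 2)) (P.inv_mem hd)

theorem pureGen_add (s : ℕ → H) (i l l' : ℕ) :
    pureGen s i (l + l') =
      desc s (i + 1 + l) l' * pureGen s i l * (desc s (i + 1 + l) l')⁻¹ := by
  rw [pureGen, pureGen, desc_add]
  group

theorem commute_desc {x : H} {s : ℕ → H} {a l : ℕ}
    (h : ∀ k, a ≤ k → k < a + l → Commute x (s k)) : Commute x (desc s a l) := by
  have := desc_mem (P := Subgroup.centralizer {x}) (s := s) (a := a) (l := l) fun k h1 h2 =>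
    Subgroup.mem_centralizer_singleton_iff.2 (h k h1 h2).symm
  exact (Subgroup.mem_centralizer_singleton_iff.1 this).symm

theorem commute_pureGen {x : H} {s : ℕ → H} {i l : ℕ}
    (h : ∀ k, i ≤ k → k < i + 1 + l → Commute x (s k)) : Commute x (pureGen s i l) := by
  have := pureGen_mem (P := Subgroup.centralizer {x}) (s := s) (i := i) (l := l) fun k h1 h2 =>
    Subgroup.mem_centralizer_singleton_iff.2 (h k h1 h2).symm
  exact (Subgroup.mem_centralizer_singleton_iff.1 this).symm

namespace IsBraidSeq

variable {n : ℕ} {s : ℕ → H}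

theorem mono (hs : IsBraidSeq n s) {n' : ℕ} (h : n' ≤ n) : IsBraidSeq n' s :=
  ⟨fun k l h1 h2 h3 => hs.far k l h1 h2 (by omega), fun k h1 h2 => hs.braid k h1 (by omega)⟩

theorem shift {m : ℕ} (hs : IsBraidSeq (m + n) s) : IsBraidSeq n fun k => s (m + k) :=
  ⟨fun k l h1 h2 h3 => hs.far _ _ (by omega) (by omega) (by omega),
    fun k h1 h2 => hs.braid (m + k) (by omega) (by omega)⟩

theorem mul_desc (hs : IsBraidSeq n s) {a k l : ℕ} (ha : 1 ≤ a) (hk : a ≤ k) (hkl : k + 1 < a + l)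
    (hl : a + l ≤ n + 1) : s k * desc s a l = desc s a l * s (k + 1) := by
  induction l with
  | zero => omega
  | succ l ih =>
    rcases Nat.lt_or_ge (k + 1) (a + l) with h | h
    · rw [desc, mul_assoc, ← ih h (by omega), ← mul_assoc, ← mul_assoc,
        (hs.far k (a + l) (by omega) (by omega) (by omega)).eq]
    · obtain ⟨l, rfl⟩ : ∃ l', l = l' + 1 := ⟨l - 1, by omega⟩
      obtain rfl : k = a + l := by omega
      have hc : Commute (s (a + l + 1)) (desc s a l) := commute_desc fun j h1 h2 =>
        (hs.far j _ (by omega) (by omega) (by omega)).symm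
      rw [desc, desc, ← add_assoc, ← mul_assoc, ← mul_assoc, hs.braid _ (by omega) (by omega),
        mul_assoc, hc.eq]
      simp only [mul_assoc]

/-- `s k` commutes with the pure generator `a_{i, i + 1 + l}` if `k` lies strictly between. -/
theorem commute_pureGen_of_lt (hs : IsBraidSeq n s) {i k l : ℕ} (hi : 1 ≤ i) (hik : i < k)
    (hk : k < i + l) (hl : i + l ≤ n) : Commute (s k) (pureGen s i l) := by
  have h1 := hs.mul_desc (a := i + 1) (k := k) (l := l) (by omega) (by omega) (by omega) (by omega)
  have h2 : Commute (s (k + 1)) (s i ^ 2) :=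
    ((hs.far i (k + 1) hi (by omega) (by omega)).symm).pow_right 2
  have h3 : s k = desc s (i + 1) l * s (k + 1) * (desc s (i + 1) l)⁻¹ := by
    rw [← h1]; group
  rw [h3, pureGen]
  exact h2.conj _

/-- The relation `a_{k, N} ↦ a_{k + 1, N}` under conjugation by `s k`. -/
theorem mul_pureGen (hs : IsBraidSeq n s) {k l : ℕ} (hk : 1 ≤ k) (hl : k + 1 + l ≤ n) :
    s k * pureGen s k (l + 1) = pureGen s (k + 1) l * s k := by
  have hc : Commute (s k) (desc s (k + 1 + 1) l) := commute_desc fun j h1 h2 =>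
    hs.far _ _ hk (by omega) (by omega)
  have hb := hs.braid k hk (by omega)
  rw [pureGen, pureGen, desc_succ']
  generalize s k = u, s (k + 1) = t, desc s (k + 1 + 1) l = d at *
  have e : u * t * u ^ 2 = t ^ 2 * u * t := by
    calc _ = (u * t * u) * u := by simp only [pow_two, mul_assoc]
      _ = t * (u * t * u) := by rw [hb]; simp only [mul_assoc]; rw [← mul_assoc u, hb, mul_assoc]
      _ = _ := by rw [hb]; simp only [pow_two, mul_assoc]
  calc _ = (u * d) * t * u ^ 2 * t⁻¹ * d⁻¹ := by group
    _ = d * (u * t * u ^ 2) * t⁻¹ * d⁻¹ := by rw [hc.eq]; group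
    _ = d * t ^ 2 * (u * d⁻¹) := by rw [e]; group
    _ = _ := by rw [hc.inv_right.eq]; group

theorem commute_mul_pureGen (hs : IsBraidSeq n s) {k l : ℕ} (hk : 1 ≤ k) (hl : k + 1 + l ≤ n) :
    Commute (s k) (pureGen s k (l + 1) * pureGen s (k + 1) l) := by
  have hc : Commute (s k) (desc s (k + 1 + 1) l) := commute_desc fun j h1 h2 =>
    hs.far _ _ hk (by omega) (by omega)
  have hb := hs.braid k hk (by omega)
  rw [pureGen, pureGen, desc_succ']
  generalize s k = u, s (k + 1) = t, desc s (k + 1 + 1) l = d at *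
  have e : d * t * u ^ 2 * (d * t)⁻¹ * (d * t ^ 2 * d⁻¹) = d * (t * u ^ 2 * t) * d⁻¹ := by group
  have h1 : Commute u (t * u ^ 2 * t) := by
    calc _ = (u * t * u) * u * t := by simp only [pow_two, mul_assoc]
      _ = t * u * (t * u * t) := by rw [hb]; simp only [mul_assoc]
      _ = _ := by rw [← hb]; simp only [pow_two, mul_assoc]
  rw [e]
  exact (hc.mul_right h1).mul_right hc.inv_right

theorem commute_pureGen_of_gt (hs : IsBraidSeq n s) {i k l : ℕ} (hk : 1 ≤ k) (hik : k + 1 < i)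
    (hl : i + l ≤ n) : Commute (s k) (pureGen s i l) :=
  commute_pureGen fun j h1 h2 => hs.far _ _ hk (by omega) (by omega)

/-- The pure generators of consecutive lengths satisfy the type `B` relation with the next `s`. -/
theorem four (hs : IsBraidSeq n s) {i l : ℕ} (hi : 1 ≤ i) (hl : i + 1 + l ≤ n) :
    pureGen s i l * s (i + 1 + l) * pureGen s i l * s (i + 1 + l) =
      s (i + 1 + l) * pureGen s i l * s (i + 1 + l) * pureGen s i l := by
  induction l with
  | zero =>
    have hb := hs.braid i hi (by omega)
    simp only [pureGen, desc, add_zero, one_mul, inv_one, mul_one]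
    generalize s i = u, s (i + 1) = t at *
    calc _ = u * (u * t * u) * u * t := by simp only [pow_two, mul_assoc]
      _ = u * (t * u * t) * u * t := by rw [hb]
      _ = (u * t * u) * (t * u * t) := by simp only [mul_assoc]
      _ = (t * u * t) * (u * t * u) := by rw [hb]
      _ = t * u * (t * u * t) * u := by simp only [mul_assoc]
      _ = _ := by rw [← hb]; simp only [pow_two, mul_assoc]
  | succ l ih =>
    have hx : pureGen s i (l + 1) = s (i + 1 + l) * pureGen s i l * (s (i + 1 + l))⁻¹ := by
      rw [pureGen_add]; simp [desc]
    have hb := hs.braid (i + 1 + l) (by omega) (by omega)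
    have hc : Commute (s (i + 1 + l + 1)) (pureGen s i l) := commute_pureGen fun j h1 h2 =>
      (hs.far _ _ (by omega) (by omega) (by omega)).symm
    have ih := ih (by omega)
    rw [hx, ← add_assoc]
    generalize s (i + 1 + l) = u, s (i + 1 + l + 1) = t, pureGen s i l = y at *
    have h1 : u⁻¹ * t * u = t * u * t⁻¹ := by
      calc _ = u⁻¹ * (t * u * t) * t⁻¹ := by group
        _ = _ := by rw [← hb]; group
    have h2 : t⁻¹ * u⁻¹ * t = u * t⁻¹ * u⁻¹ := by
      calc _ = t⁻¹ * u⁻¹ * (t * u * t) * t⁻¹ * u⁻¹ := by group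
        _ = _ := by rw [← hb]; group
    calc _ = u * y * (u⁻¹ * t * u) * y * u⁻¹ * t := by group
      _ = u * (y * t) * u * (t⁻¹ * y) * u⁻¹ * t := by rw [h1]; group
      _ = u * t * y * u * y * (t⁻¹ * u⁻¹ * t) := by
        rw [← hc.eq, hc.inv_left.eq]; group
      _ = u * t * (y * u * y * u) * t⁻¹ * u⁻¹ := by rw [h2]; group
      _ = (u * t * u) * y * u * y * t⁻¹ * u⁻¹ := by rw [ih]; group
      _ = t * u * (t * y) * u * (y * t⁻¹) * u⁻¹ := by rw [hb]; group
      _ = t * u * y * (t * u * t⁻¹) * y * u⁻¹ := by rw [hc.eq, ← hc.inv_left.eq]; group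
      _ = _ := by rw [← h1]; group

end IsBraidSeq

/-- Relators of the braid group on infinitely many strands, with generators indexed by `ℕ`. -/
def infBraidRels : Set (FreeGroup ℕ) :=
  {x | ∃ k l : ℕ, k + 2 ≤ l ∧ x = of k * of l * (of l * of k)⁻¹} ∪
  {x | ∃ k : ℕ, x = of k * of (k + 1) * of k * (of (k + 1) * of k * of (k + 1))⁻¹}

/-- The braid group on infinitely many strands. -/
abbrev InfBraid : Type := PresentedGroup infBraidRels

namespace InfBraid

/-- The generator of `InfBraid` crossing the strands `k` and `k + 1`. -/
def σ (k : ℕ) : InfBraid := PresentedGroup.of k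

theorem σ_far {k l : ℕ} (h : k + 2 ≤ l) : Commute (σ k) (σ l) :=
  PresentedGroup.mk_eq_mk_of_mul_inv_mem (Or.inl ⟨k, l, h, rfl⟩)

theorem σ_braid (k : ℕ) : σ k * σ (k + 1) * σ k = σ (k + 1) * σ k * σ (k + 1) :=
  PresentedGroup.mk_eq_mk_of_mul_inv_mem (Or.inr ⟨k, rfl⟩)

theorem isBraidSeq_σ (n : ℕ) : IsBraidSeq n σ :=
  ⟨fun _ _ _ h _ => σ_far h, fun k _ _ => σ_braid k⟩

/-- The homomorphism out of `InfBraid` given by a sequence satisfying the braid relations. -/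
def lift (s : ℕ → H) (far : ∀ k l, k + 2 ≤ l → s k * s l = s l * s k)
    (braid : ∀ k, s k * s (k + 1) * s k = s (k + 1) * s k * s (k + 1)) : InfBraid →* H :=
  PresentedGroup.toGroup (f := s) (by
    rintro _ (⟨k, l, h, rfl⟩ | ⟨k, rfl⟩)
    · simpa only [_root_.map_mul, _root_.map_inv, FreeGroup.lift_apply_of, mul_inv_eq_one]
        using far k l h
    · simpa only [_root_.map_mul, _root_.map_inv, FreeGroup.lift_apply_of, mul_inv_eq_one]
        using braid k)

@[simp]
theorem lift_σ (s : ℕ → H) (far braid) (k : ℕ) : lift s far braid (σ k) = s k :=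
  PresentedGroup.toGroup.of _

/-- The endomorphism `x_j ↦ x_{j+1}`, `x_{j+1} ↦ x_{j+1}⁻¹ x_j x_{j+1}` of the free group. -/
def artinHom (j : ℕ) : FreeGroup ℕ →* FreeGroup ℕ :=
  FreeGroup.lift fun i =>
    if i = j then of (j + 1) else if i = j + 1 then (of (j + 1))⁻¹ * of j * of (j + 1) else of i

/-- The inverse of `artinHom`. -/
def artinInv (j : ℕ) : FreeGroup ℕ →* FreeGroup ℕ :=
  FreeGroup.lift fun i =>
    if i = j + 1 then of j else if i = j then of j * of (j + 1) * (of j)⁻¹ else of i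

theorem artinHom_self (j : ℕ) : artinHom j (of j) = of (j + 1) := by simp [artinHom]

theorem artinHom_succ (j : ℕ) :
    artinHom j (of (j + 1)) = (of (j + 1))⁻¹ * of j * of (j + 1) := by simp [artinHom]

theorem artinHom_of_ne {i j : ℕ} (h : i ≠ j) (h' : i ≠ j + 1) : artinHom j (of i) = of i := by
  simp [artinHom, h, h']

theorem artinInv_self (j : ℕ) : artinInv j (of j) = of j * of (j + 1) * (of j)⁻¹ := by
  simp [artinInv]

theorem artinInv_succ (j : ℕ) : artinInv j (of (j + 1)) = of j := by simp [artinInv]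

theorem artinInv_of_ne {i j : ℕ} (h : i ≠ j) (h' : i ≠ j + 1) : artinInv j (of i) = of i := by
  simp [artinInv, h, h']

/-- Artin's automorphism of the free group attached to the `j`-th crossing. -/
def artinAut (j : ℕ) : MulAut (FreeGroup ℕ) :=
  MonoidHom.toMulEquiv (artinHom j) (artinInv j)
    (by
      ext i
      by_cases h : i = j
      · subst h; simp [artinHom_self, artinInv_succ]
      by_cases h' : i = j + 1
      · subst h'; simp [artinHom_succ, artinInv_succ, artinInv_self, mul_assoc]
      simp [artinHom_of_ne h h', artinInv_of_ne h h'])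
    (by
      ext i
      by_cases h : i = j
      · subst h; simp [artinHom_self, artinHom_succ, artinInv_self, mul_assoc]
      by_cases h' : i = j + 1
      · subst h'; simp [artinHom_self, artinInv_succ]
      simp [artinHom_of_ne h h', artinInv_of_ne h h'])

theorem artinAut_apply (j : ℕ) (x : FreeGroup ℕ) : artinAut j x = artinHom j x := rfl

theorem artinAut_far (k l : ℕ) (h : k + 2 ≤ l) :
    artinAut k * artinAut l = artinAut l * artinAut k := by
  have e : (artinHom k).comp (artinHom l) = (artinHom l).comp (artinHom k) := by
    ext i
    by_cases h1 : i = k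
    · subst h1
      simp [artinHom_self, artinHom_of_ne (show i ≠ l by omega) (by omega),
        artinHom_of_ne (show i + 1 ≠ l by omega) (by omega)]
    by_cases h2 : i = k + 1
    · subst h2
      simp [artinHom_succ, artinHom_of_ne (show k ≠ l by omega) (by omega),
        artinHom_of_ne (show k + 1 ≠ l by omega) (by omega)]
    by_cases h3 : i = l
    · subst h3
      simp [artinHom_self, artinHom_of_ne (show i ≠ k by omega) (by omega),
        artinHom_of_ne (show i + 1 ≠ k by omega) (by omega)]
    by_cases h4 : i = l + 1
    · subst h4
      simp [artinHom_succ, artinHom_of_ne (show l ≠ k by omega) (by omega),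
        artinHom_of_ne (show l + 1 ≠ k by omega) (by omega)]
    simp [artinHom_of_ne h1 h2, artinHom_of_ne h3 h4]
  exact MulEquiv.ext fun x => DFunLike.congr_fun e x

theorem artinAut_braid (k : ℕ) :
    artinAut k * artinAut (k + 1) * artinAut k =
      artinAut (k + 1) * artinAut k * artinAut (k + 1) := by
  have e : ((artinHom k).comp (artinHom (k + 1))).comp (artinHom k) =
      ((artinHom (k + 1)).comp (artinHom k)).comp (artinHom (k + 1)) := by
    have hk1 := artinHom_of_ne (show k ≠ k + 1 by omega) (by omega)
    have hk2 := artinHom_of_ne (show k + 1 + 1 ≠ k by omega) (by omega)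
    have hk3 := artinHom_succ (k + 1)
    ext i
    by_cases h1 : i = k
    · subst h1; simp [artinHom_self, hk1, hk2]
    by_cases h2 : i = k + 1
    · subst h2; simp [artinHom_self, artinHom_succ, hk1, hk2]
    by_cases h3 : i = k + 1 + 1
    · subst h3
      simp [artinHom_self, artinHom_succ, hk1, hk2, hk3, mul_assoc]
    simp [artinHom_of_ne h1 h2, artinHom_of_ne h2 h3]
  exact MulEquiv.ext fun x => DFunLike.congr_fun e x

/-- Artin's action of the braid group on the free group. -/
def artin : InfBraid →* MulAut (FreeGroup ℕ) := lift artinAut artinAut_far artinAut_braid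

/-- The semidirect product of the free group by the braid group along Artin's action. -/
abbrev FreeBraid : Type := FreeGroup ℕ ⋊[artin] InfBraid

open SemidirectProduct

/-- The free generators inside `FreeBraid`. -/
def fx (i : ℕ) : FreeBraid := inl (of i)

/-- The crossings inside `FreeBraid`. -/
def fs (i : ℕ) : FreeBraid := inr (σ i)

theorem fs_far {k l : ℕ} (h : k + 2 ≤ l) : fs k * fs l = fs l * fs k := by
  rw [fs, fs, ← _root_.map_mul, (σ_far h).eq, _root_.map_mul]

theorem fs_braid (k : ℕ) : fs k * fs (k + 1) * fs k = fs (k + 1) * fs k * fs (k + 1) := by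
  simpa only [_root_.map_mul, fs] using congrArg (inr : InfBraid →* FreeBraid) (σ_braid k)

theorem fs_mul_inl (k : ℕ) (x : FreeGroup ℕ) : fs k * inl x = inl (artinHom k x) * fs k := by
  have e : artin (σ k) x = artinHom k x := by rw [artin, lift_σ, artinAut_apply]
  have h := inl_aut (φ := artin) (σ k) x
  rw [e] at h
  rw [fs, h, mul_assoc, ← _root_.map_mul, inv_mul_cancel, _root_.map_one, mul_one]

theorem fs_mul_fx_self (k : ℕ) : fs k * fx k = fx (k + 1) * fs k := by
  rw [fx, fs_mul_inl, artinHom_self, fx]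

theorem fs_mul_fx_of_ne {i k : ℕ} (h : i ≠ k) (h' : i ≠ k + 1) : fs k * fx i = fx i * fs k := by
  rw [fx, fs_mul_inl, artinHom_of_ne h h']

theorem fs_mul_fx_mul_fx (k : ℕ) : fs k * (fx k * fx (k + 1)) = fx k * fx (k + 1) * fs k := by
  rw [fx, fx, ← _root_.map_mul, fs_mul_inl, _root_.map_mul, artinHom_self, artinHom_succ]
  congr 2
  group

/-- The action of the `j`-th crossing on pairs of a strand and an element of `FreeBraid`: the
monomial matrix of left multiplication with respect to the coset representatives
`(σ_{N-1} ⋯ σ_k)⁻¹`. -/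
def crossing (j : ℕ) : Equiv.Perm (ℕ × FreeBraid) where
  toFun x :=
    if j + 1 < x.1 then (x.1, fs j * x.2)
    else if x.1 = j + 1 then (j, fx j * x.2)
    else if x.1 = j then (j + 1, x.2)
    else (x.1, fs (j - 1) * x.2)
  invFun x :=
    if j + 1 < x.1 then (x.1, (fs j)⁻¹ * x.2)
    else if x.1 = j + 1 then (j, x.2)
    else if x.1 = j then (j + 1, (fx j)⁻¹ * x.2)
    else (x.1, (fs (j - 1))⁻¹ * x.2)
  left_inv := by
    rintro ⟨k, p⟩
    dsimp only
    split_ifs <;> simp_all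
  right_inv := by
    rintro ⟨k, p⟩
    dsimp only
    split_ifs <;> simp_all

theorem crossing_of_gt {j k : ℕ} (h : j + 1 < k) (p : FreeBraid) :
    crossing j (k, p) = (k, fs j * p) := if_pos h

theorem crossing_succ (j : ℕ) (p : FreeBraid) : crossing j (j + 1, p) = (j, fx j * p) := by
  simp [crossing]

theorem crossing_self (j : ℕ) (p : FreeBraid) : crossing j (j, p) = (j + 1, p) := by
  simp [crossing]

theorem crossing_of_lt {j k : ℕ} (h : k ≤ j) (p : FreeBraid) :
    crossing (j + 1) (k, p) = (k, fs j * p) := by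
  simp [crossing, show ¬ j + 1 + 1 < k by omega, show k ≠ j + 1 + 1 by omega,
    show k ≠ j + 1 by omega]

theorem crossing_far (j l : ℕ) (h : j + 2 ≤ l) :
    crossing j * crossing l = crossing l * crossing j := by
  obtain ⟨l, rfl⟩ : ∃ l', l = l' + 1 := ⟨l - 1, by omega⟩
  ext1 ⟨k, p⟩
  simp only [Equiv.Perm.mul_apply]
  rcases lt_trichotomy k (l + 1) with hk | rfl | hk
  · rw [crossing_of_lt (show k ≤ l by omega)]
    rcases lt_trichotomy k j with hj | rfl | hj
    · obtain ⟨j, rfl⟩ : ∃ j', j = j' + 1 := ⟨j - 1, by omega⟩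
      rw [crossing_of_lt (show k ≤ j by omega), crossing_of_lt (show k ≤ j by omega),
        crossing_of_lt (show k ≤ l by omega), ← mul_assoc, ← mul_assoc, fs_far (by omega)]
    · rw [crossing_self, crossing_self, crossing_of_lt (by omega)]
    · rcases Nat.lt_or_ge (j + 1) k with hj' | hj'
      · rw [crossing_of_gt hj', crossing_of_gt hj', crossing_of_lt (show k ≤ l by omega),
          ← mul_assoc, ← mul_assoc, fs_far (by omega)]
      · obtain rfl : k = j + 1 := by omega
        rw [crossing_succ, crossing_succ, crossing_of_lt (by omega), ← mul_assoc, ← mul_assoc,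
          fs_mul_fx_of_ne (by omega) (by omega)]
  · rw [crossing_self, crossing_of_gt (by omega), crossing_of_gt (show j + 1 < l + 1 by omega),
      crossing_self]
  · rw [crossing_of_gt (show j + 1 < k by omega)]
    rcases Nat.lt_or_ge (l + 1 + 1) k with hk' | hk'
    · rw [crossing_of_gt hk', crossing_of_gt hk', crossing_of_gt (show j + 1 < k by omega),
        ← mul_assoc, ← mul_assoc, fs_far (by omega)]
    · obtain rfl : k = l + 1 + 1 := by omega
      rw [crossing_succ, crossing_succ, crossing_of_gt (show j + 1 < l + 1 by omega),
        ← mul_assoc, ← mul_assoc, fs_mul_fx_of_ne (by omega) (by omega)]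

theorem crossing_braid (j : ℕ) :
    crossing j * crossing (j + 1) * crossing j =
      crossing (j + 1) * crossing j * crossing (j + 1) := by
  ext1 ⟨k, p⟩
  simp only [Equiv.Perm.mul_apply]
  rcases lt_trichotomy k j with hk | rfl | hk
  · obtain ⟨j, rfl⟩ : ∃ j', j = j' + 1 := ⟨j - 1, by omega⟩
    simp only [crossing_of_lt (show k ≤ j by omega), crossing_of_lt (show k ≤ j + 1 by omega),
      ← mul_assoc, fs_braid]
  · rw [crossing_self, crossing_self, crossing_of_gt (by omega), crossing_of_lt le_rfl,
      crossing_self, crossing_self]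
  rcases Nat.lt_or_ge (j + 2) k with h | h
  · simp only [crossing_of_gt (show j + 1 < k by omega),
      crossing_of_gt (show j + 1 + 1 < k by omega),
      ← mul_assoc, fs_braid]
  rcases Nat.lt_or_ge (j + 1) k with h' | h'
  · obtain rfl : k = j + 1 + 1 := by omega
    rw [crossing_of_gt (show j + 1 < j + 1 + 1 by omega), crossing_succ (j + 1), crossing_succ,
      crossing_succ, crossing_succ, crossing_of_lt le_rfl, ← mul_assoc, ← mul_assoc, ← mul_assoc,
      ← fs_mul_fx_mul_fx]
    simp only [mul_assoc]
  · obtain rfl : k = j + 1 := by omega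
    rw [crossing_succ, crossing_of_lt le_rfl, crossing_self, crossing_self,
      crossing_of_gt (show j + 1 < j + 1 + 1 by omega), crossing_succ, ← mul_assoc, ← mul_assoc,
      fs_mul_fx_self]

/-- The representation of the braid group induced from the stabilizer of a strand. -/
def strandRep : InfBraid →* Equiv.Perm (ℕ × FreeBraid) := lift crossing crossing_far crossing_braid

theorem strandRep_σ (j : ℕ) : strandRep (σ j) = crossing j := lift_σ ..

theorem strandRep_desc (k l : ℕ) (p : FreeBraid) :
    strandRep (desc σ k l) (k, p) = (k + l, p) := by
  induction l with
  | zero => simp [desc]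
  | succ l ih =>
    rw [desc, _root_.map_mul, Equiv.Perm.mul_apply, ih, strandRep_σ, crossing_self, add_assoc]

theorem strandRep_desc_inv (k l : ℕ) (p : FreeBraid) :
    strandRep (desc σ k l)⁻¹ (k + l, p) = (k, p) := by
  rw [_root_.map_inv, Equiv.Perm.inv_eq_iff_eq, strandRep_desc]

theorem strandRep_pureGen (i l : ℕ) (p : FreeBraid) :
    strandRep (pureGen σ i l) (i + 1 + l, p) = (i + 1 + l, fx i * p) := by
  rw [pureGen, _root_.map_mul, Equiv.Perm.mul_apply, strandRep_desc_inv, _root_.map_mul,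
    Equiv.Perm.mul_apply, pow_two, _root_.map_mul, Equiv.Perm.mul_apply, strandRep_σ, crossing_succ, crossing_self,
    strandRep_desc]

/-- The elements acting on the strand `k` as on the second factor. -/
def fixing (k : ℕ) : Subgroup InfBraid where
  carrier := {x | ∀ p, strandRep x (k, p) = (k, inr x * p)}
  one_mem' p := by simp
  mul_mem' {x y} hx hy p := by
    rw [_root_.map_mul, Equiv.Perm.mul_apply, hy, hx, _root_.map_mul, mul_assoc]
  inv_mem' {x} hx p := by
    rw [_root_.map_inv, Equiv.Perm.inv_eq_iff_eq, hx, ← mul_assoc, ← _root_.map_mul]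
    simp

theorem σ_mem_fixing {j k : ℕ} (h : j + 1 < k) : σ j ∈ fixing k := fun p => by
  rw [strandRep_σ, crossing_of_gt h, fs]

end InfBraid

/-- `y 1, …, y m` and `t 1, …, t q` satisfy the irredundant relations of the mixed braid group
with `q + 1` moving strands. -/
structure IsMixedSeq (m q : ℕ) (y t : ℕ → H) : Prop where
  isBraidSeq : IsBraidSeq q t
  comm : ∀ i k, 1 ≤ i → i ≤ m → 2 ≤ k → k ≤ q → Commute (y i) (t k)
  four : ∀ i, 1 ≤ i → i ≤ m → 1 ≤ q → y i * t 1 * y i * t 1 = t 1 * y i * t 1 * y i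
  nest : ∀ i r, 1 ≤ r → r < i → i ≤ m → 1 ≤ q → Commute (y i) (t 1 * y r * (t 1)⁻¹)

theorem IsBraidSeq.isMixedSeq {m q : ℕ} {s : ℕ → H} (hs : IsBraidSeq (m + q) s) :
    IsMixedSeq m q (fun i => pureGen s i (m - i)) fun k => s (m + k) where
  isBraidSeq := hs.shift
  comm i k _ _ _ _ := (commute_pureGen fun j _ _ =>
    (hs.far j (m + k) (by omega) (by omega) (by omega)).symm).symm
  four i h1 h2 h3 := by
    have h := hs.four h1 (l := m - i) (by omega)
    rwa [show i + 1 + (m - i) = m + 1 by omega] at h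
  nest i r h1 h2 h3 h4 := by
    have e : s (m + 1) * pureGen s r (m - r) * (s (m + 1))⁻¹ = pureGen s r (m - r + 1) := by
      rw [pureGen_add, show r + 1 + (m - r) = m + 1 by omega]
      simp [desc]
    rw [e]
    exact (commute_pureGen fun k _ _ => (hs.commute_pureGen_of_lt h1 (by omega) (by omega)
      (by omega)).symm).symm

/-- The elements of a group which both conjugation by `g` and by `g⁻¹` move into `F`. -/
def conjInto (F : Subgroup H) (g : H) : Subgroup H :=
  F.comap (MulAut.conj g).toMonoidHom ⊓ F.comap (MulAut.conj g⁻¹).toMonoidHom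

section conjInto

variable {F : Subgroup H} {g x z : H}

theorem mem_conjInto : x ∈ conjInto F g ↔ g * x * g⁻¹ ∈ F ∧ g⁻¹ * x * g ∈ F := by
  simp [conjInto, Subgroup.mem_inf]

theorem mem_conjInto_of_commute (hx : x ∈ F) (h : Commute g x) : x ∈ conjInto F g := by
  have h2 : g⁻¹ * x * g = x := by rw [mul_assoc, ← h.eq, inv_mul_cancel_left]
  rw [mem_conjInto, h2, h.eq, mul_inv_cancel_right]
  exact ⟨hx, hx⟩

theorem mem_conjInto_right (hx : x ∈ F) (hz : z ∈ F) (h : Commute g (x * z))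
    (hg : x ∈ conjInto F g) : z ∈ conjInto F g := by
  have := mul_mem (inv_mem hg) (mem_conjInto_of_commute (mul_mem hx hz) h)
  rwa [inv_mul_cancel_left] at this

theorem mem_conjInto_of_eq {a b : H} (ha : a ∈ F) (hb : b ∈ F) (hcomm : Commute z (a * b))
    (hrel : z * a * z⁻¹ = b⁻¹ * a * b) : a ∈ conjInto F z := by
  refine mem_conjInto.2 ⟨by rw [hrel]; exact mul_mem (mul_mem (inv_mem hb) ha) hb, ?_⟩
  have h1 : z⁻¹ * b * z = a * b * a⁻¹ := by
    have : b * z * a = a * b * z := by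
      calc _ = b * (z * a * z⁻¹) * z := by group
        _ = _ := by rw [hrel]; group
    calc _ = z⁻¹ * (b * z * a) * a⁻¹ := by group
      _ = z⁻¹ * (a * b * z) * a⁻¹ := by rw [this]
      _ = _ := by rw [← hcomm.eq]; group
  have h2 : z⁻¹ * a * z = a * b * (a * b * a⁻¹)⁻¹ := by
    rw [← h1]
    calc _ = z⁻¹ * (a * b * z) * z⁻¹ * b⁻¹ * z := by group
      _ = _ := by rw [← hcomm.eq]; group
  rw [h2]
  exact mul_mem (mul_mem ha hb) (inv_mem (mul_mem (mul_mem ha hb) (inv_mem ha)))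

theorem mem_normalizer_of_le_conjInto (h : F ≤ conjInto F g) : g ∈ Subgroup.normalizer F := by
  refine Subgroup.mem_normalizer_iff.2 fun x => ⟨fun hx => (mem_conjInto.1 (h hx)).1, fun hx => ?_⟩
  have := (mem_conjInto.1 (h hx)).2
  rwa [show g⁻¹ * (g * x * g⁻¹) * g = x by group] at this

end conjInto

/-- The pure generator linking the `i`-th strand with the last of `m + q + 2` strands, in terms
of the generators `y` and `t` of the mixed braid group. -/
def lastGen (m q : ℕ) (y t : ℕ → H) (i : ℕ) : H :=
  if i ≤ m then desc t 1 (q + 1) * y i * (desc t 1 (q + 1))⁻¹ else pureGen t (i - m) (m + q + 1 - i)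

/-- The subgroup generated by the pure generators involving the last strand. -/
def lastSubgroup (m q : ℕ) (y t : ℕ → H) : Subgroup H :=
  Subgroup.closure (lastGen m q y t '' Set.Icc 1 (m + q + 1))

/-- The subgroup generated by `y 1, …, y m` and `t 1, …, t q`. -/
def mixedSubgroup (m q : ℕ) (y t : ℕ → H) : Subgroup H :=
  Subgroup.closure (y '' Set.Icc 1 m ∪ t '' Set.Icc 1 q)

namespace IsMixedSeq

variable {m q : ℕ} {y t : ℕ → H}

theorem mono (h : IsMixedSeq m (q + 1) y t) : IsMixedSeq m q y t where
  isBraidSeq := h.isBraidSeq.mono (by omega)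
  comm i k h1 h2 h3 h4 := h.comm i k h1 h2 h3 (by omega)
  four i h1 h2 _ := h.four i h1 h2 (by omega)
  nest i r h1 h2 h3 _ := h.nest i r h1 h2 h3 (by omega)

theorem conj_mem_lastSubgroup {i : ℕ} (h1 : 1 ≤ i) (h2 : i ≤ m) :
    desc t 1 (q + 1) * y i * (desc t 1 (q + 1))⁻¹ ∈ lastSubgroup m q y t :=
  Subgroup.subset_closure ⟨i, ⟨h1, by omega⟩, if_pos h2⟩

theorem pureGen_mem_lastSubgroup {j l : ℕ} (h1 : 1 ≤ j) (h2 : j + l = q + 1) :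
    pureGen t j l ∈ lastSubgroup m q y t := by
  refine Subgroup.subset_closure ⟨m + j, ⟨by omega, by omega⟩, ?_⟩
  rw [lastGen, if_neg (by omega)]
  congr 1 <;> omega

theorem lastSubgroup_le {P : Subgroup H}
    (hy : ∀ i, 1 ≤ i → i ≤ m → desc t 1 (q + 1) * y i * (desc t 1 (q + 1))⁻¹ ∈ P)
    (ht : ∀ j l, 1 ≤ j → j + l = q + 1 → pureGen t j l ∈ P) : lastSubgroup m q y t ≤ P := by
  rw [lastSubgroup, Subgroup.closure_le]
  rintro _ ⟨i, ⟨h1, h2⟩, rfl⟩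
  by_cases h : i ≤ m
  · rw [lastGen, if_pos h]
    exact hy i h1 h
  · rw [lastGen, if_neg h]
    exact ht _ _ (by omega) (by omega)

theorem t_mem_normalizer (h : IsMixedSeq m (q + 1) y t) {k : ℕ} (hk : 1 ≤ k) (hkq : k ≤ q) :
    t k ∈ Subgroup.normalizer (lastSubgroup m q y t : Set H) := by
  refine mem_normalizer_of_le_conjInto (lastSubgroup_le (fun i h1 h2 => ?_) fun j l h1 h2 => ?_)
  · refine mem_conjInto_of_commute (conj_mem_lastSubgroup h1 h2) ?_
    have hs := h.isBraidSeq.mul_desc (a := 1) (k := k) (l := q + 1) le_rfl hk (by omega) (by omega)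
    have e : t k = desc t 1 (q + 1) * t (k + 1) * (desc t 1 (q + 1))⁻¹ := by
      rw [← hs, mul_inv_cancel_right]
    rw [e]
    exact (h.comm i (k + 1) h1 h2 (by omega) (by omega)).symm.conj _
  · have hself : ∀ l, k + 1 + l = q + 1 →
        pureGen t k (l + 1) ∈ conjInto (lastSubgroup m q y t) (t k) := by
      intro l hl
      have hx := pureGen_mem_lastSubgroup (m := m) (q := q) (y := y) (t := t) hk
        (show k + (l + 1) = q + 1 by omega)
      have hz := pureGen_mem_lastSubgroup (m := m) (q := q) (y := y) (t := t)
        (show 1 ≤ k + 1 by omega) hl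
      have h3 := h.isBraidSeq.mul_pureGen hk (l := l) (by omega)
      have h4 := h.isBraidSeq.commute_mul_pureGen hk (l := l) (by omega)
      generalize pureGen t k (l + 1) = x, pureGen t (k + 1) l = z, t k = g at *
      refine mem_conjInto.2 ⟨by rwa [h3, mul_inv_cancel_right], ?_⟩
      have e : g⁻¹ * x * g = x * z * x⁻¹ := by
        calc _ = g⁻¹ * (x * z) * z⁻¹ * g := by group
          _ = x * z * (g⁻¹ * (z * g) )⁻¹:= by rw [h4.inv_left.eq]; group
          _ = _ := by rw [← h3, inv_mul_cancel_left]
      rw [e]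
      exact mul_mem (mul_mem hx hz) (inv_mem hx)
    have hm := pureGen_mem_lastSubgroup (m := m) (q := q) (y := y) (t := t) h1 h2
    rcases lt_trichotomy j k with hjk | rfl | hjk
    · exact mem_conjInto_of_commute hm
        (h.isBraidSeq.commute_pureGen_of_lt h1 hjk (by omega) (by omega))
    · obtain ⟨l, rfl⟩ : ∃ l', l = l' + 1 := ⟨l - 1, by omega⟩
      exact hself l (by omega)
    · rcases Nat.lt_or_ge (k + 1) j with hj | hj
      · exact mem_conjInto_of_commute hm
          (h.isBraidSeq.commute_pureGen_of_gt hk hj (by omega))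
      · obtain rfl : j = k + 1 := by omega
        exact mem_conjInto_right (pureGen_mem_lastSubgroup hk (by omega)) hm
          (h.isBraidSeq.commute_mul_pureGen hk (by omega)) (hself l h2)

theorem y_mem_normalizer (h : IsMixedSeq m (q + 1) y t) {i : ℕ} (hi : 1 ≤ i) (him : i ≤ m) :
    y i ∈ Subgroup.normalizer (lastSubgroup m q y t : Set H) := by
  set F := lastSubgroup m q y t with hF
  have hd : ∀ r, 1 ≤ r → r ≤ m → Commute (y r) (desc t 2 q) := fun r h1 h2 =>
    commute_desc fun k h3 h4 => h.comm r k h1 h2 h3 (by omega)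
  have hdesc : desc t 1 (q + 1) = desc t 2 q * t 1 := desc_succ' t 1 q
  have hA : ∀ r, 1 ≤ r → r ≤ m → desc t 1 (q + 1) * y r * (desc t 1 (q + 1))⁻¹ ∈ F :=
    fun r h1 h2 => conj_mem_lastSubgroup h1 h2
  have hB : pureGen t 1 q ∈ F := pureGen_mem_lastSubgroup le_rfl (by omega)
  have four := h.four i hi him (by omega)
  have hi_d := hd i hi him
  have hcomm : Commute (y i)
      (desc t 1 (q + 1) * y i * (desc t 1 (q + 1))⁻¹ * pureGen t 1 q) := by
    have e : desc t 1 (q + 1) * y i * (desc t 1 (q + 1))⁻¹ * pureGen t 1 q =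
        desc t 2 q * (t 1 * y i * t 1) * (desc t 2 q)⁻¹ := by
      rw [hdesc, pureGen]; group
    have h1 : Commute (y i) (t 1 * y i * t 1) := by
      rw [Commute, SemiconjBy, ← four]; simp only [mul_assoc]
    rw [e]
    exact (hi_d.mul_right h1).mul_right hi_d.inv_right
  have hrel : y i * (desc t 1 (q + 1) * y i * (desc t 1 (q + 1))⁻¹) * (y i)⁻¹ =
      (pureGen t 1 q)⁻¹ * (desc t 1 (q + 1) * y i * (desc t 1 (q + 1))⁻¹) * pureGen t 1 q := by
    rw [hdesc, pureGen]
    generalize desc t 2 q = d, t 1 = u, y i = z at *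
    have e : z * u * z * u⁻¹ * z⁻¹ = u⁻¹ * z * u := by
      calc _ = u⁻¹ * (u * z * u * z) * u⁻¹ * z⁻¹ := by group
        _ = _ := by rw [← four]; group
    calc _ = (z * d) * u * z * u⁻¹ * (d⁻¹ * z⁻¹) := by group
      _ = d * (z * u * z * u⁻¹ * z⁻¹) * d⁻¹ := by rw [hi_d.eq, ← hi_d.inv_inv.eq]; group
      _ = _ := by rw [e]; group
  have hself : desc t 1 (q + 1) * y i * (desc t 1 (q + 1))⁻¹ ∈ conjInto F (y i) :=
    mem_conjInto_of_eq (hA i hi him) hB hcomm hrel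
  have hone : pureGen t 1 q ∈ conjInto F (y i) := mem_conjInto_right (hA i hi him) hB hcomm hself
  refine mem_normalizer_of_le_conjInto (lastSubgroup_le (fun r h1 h2 => ?_) fun j l h1 h2 => ?_)
  · rcases lt_trichotomy r i with hri | rfl | hri
    · refine mem_conjInto_of_commute (hA r h1 h2) ?_
      have e : desc t 1 (q + 1) * y r * (desc t 1 (q + 1))⁻¹ =
          desc t 2 q * (t 1 * y r * (t 1)⁻¹) * (desc t 2 q)⁻¹ := by
        rw [hdesc]; group
      rw [e]
      exact (hi_d.mul_right (h.nest i r h1 hri him (by omega))).mul_right hi_d.inv_right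
    · exact hself
    · have hn := h.nest r i hi hri h2 (by omega)
      have e : (pureGen t 1 q)⁻¹ * (desc t 1 (q + 1) * y r * (desc t 1 (q + 1))⁻¹) *
          pureGen t 1 q = desc t 2 q * ((t 1)⁻¹ * y r * t 1) * (desc t 2 q)⁻¹ := by
        rw [hdesc, pureGen]; group
      have hc : Commute (y i) ((t 1)⁻¹ * y r * t 1) := by
        have := hn.symm.conj (t 1)⁻¹
        rwa [inv_inv, show (t 1)⁻¹ * (t 1 * y i * (t 1)⁻¹) * t 1 = y i by group] at this
      have hmem := mem_conjInto_of_commute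
        (mul_mem (mul_mem (inv_mem hB) (hA r h1 h2)) hB) (e ▸
          (hi_d.mul_right hc).mul_right hi_d.inv_right)
      have := mul_mem (mul_mem hone hmem) (inv_mem hone)
      convert this using 1
      group
  · rcases Nat.lt_or_ge 1 j with hj | hj
    · exact mem_conjInto_of_commute (pureGen_mem_lastSubgroup h1 h2)
        (commute_pureGen fun k h3 h4 => h.comm i k hi him (by omega) (by omega))
    · obtain rfl : j = 1 := by omega
      obtain rfl : l = q := by omega
      exact hone

theorem mixedSubgroup_le_normalizer (h : IsMixedSeq m (q + 1) y t) :
    mixedSubgroup m q y t ≤ Subgroup.normalizer (lastSubgroup m q y t : Set H) := by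
  rw [mixedSubgroup, Subgroup.closure_le]
  rintro _ (⟨i, ⟨h1, h2⟩, rfl⟩ | ⟨k, ⟨h1, h2⟩, rfl⟩)
  · exact h.y_mem_normalizer h1 h2
  · exact h.t_mem_normalizer h1 h2

end IsMixedSeq

/-- If left multiplication by each generator permutes finitely many cosets of `P`, then so does
left multiplication by each element of the generated subgroup. -/
theorem exists_perm_coset (P : Subgroup H) (R : ℕ → Prop) (c : ℕ → H) {S : Set H}
    (hS : ∀ g ∈ S, ∃ τ : Equiv.Perm ℕ, (∀ k, R (τ k) ↔ R k) ∧
      ∀ k, R k → c (τ k) * g * (c k)⁻¹ ∈ P) {g : H} (hg : g ∈ Subgroup.closure S) :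
    ∃ τ : Equiv.Perm ℕ, (∀ k, R (τ k) ↔ R k) ∧ ∀ k, R k → c (τ k) * g * (c k)⁻¹ ∈ P := by
  induction hg using Subgroup.closure_induction with
  | mem g hg => exact hS g hg
  | one => exact ⟨1, by simp, by simp⟩
  | mul g g' _ _ ih ih' =>
    obtain ⟨τ, h1, h2⟩ := ih
    obtain ⟨τ', h1', h2'⟩ := ih'
    refine ⟨τ * τ', fun k => (h1 _).trans (h1' k), fun k hk => ?_⟩
    have := mul_mem (h2 _ ((h1' k).2 hk)) (h2' k hk)
    convert this using 1
    rw [Equiv.Perm.mul_apply]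
    group
  | inv g _ ih =>
    obtain ⟨τ, h1, h2⟩ := ih
    have h3 : ∀ k, R (τ⁻¹ k) ↔ R k := fun k => by
      rw [← h1, show τ (τ⁻¹ k) = k from τ.apply_symm_apply k]
    refine ⟨τ⁻¹, h3, fun k hk => ?_⟩
    have := inv_mem (h2 _ ((h3 k).2 hk))
    rw [show τ (τ⁻¹ k) = k from τ.apply_symm_apply k] at this
    convert this using 1
    group

namespace IsMixedSeq

variable {m q : ℕ} {y t : ℕ → H}

/-- Normal form of the elements of a mixed braid group with respect to the stabilizer of the last
strand. -/
theorem exists_eq_mul (h : IsMixedSeq m (q + 1) y t) {g : H}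
    (hg : g ∈ mixedSubgroup m (q + 1) y t) :
    ∃ k l, 1 ≤ k ∧ k + l = q + 2 ∧ ∃ f ∈ lastSubgroup m q y t, ∃ x ∈ mixedSubgroup m q y t,
      g = (desc t k l)⁻¹ * (f * x) := by
  set P := lastSubgroup m q y t ⊔ mixedSubgroup m q y t with hP
  have hF : lastSubgroup m q y t ≤ P := le_sup_left
  have hM : mixedSubgroup m q y t ≤ P := le_sup_right
  have hyP : ∀ i, 1 ≤ i → i ≤ m → y i ∈ P := fun i h1 h2 =>
    hM (Subgroup.subset_closure (Or.inl ⟨i, ⟨h1, h2⟩, rfl⟩))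
  have htP : ∀ k, 1 ≤ k → k ≤ q → t k ∈ P := fun k h1 h2 =>
    hM (Subgroup.subset_closure (Or.inr ⟨k, ⟨h1, h2⟩, rfl⟩))
  have hgen : ∀ g ∈ y '' Set.Icc 1 m ∪ t '' Set.Icc 1 (q + 1),
      ∃ τ : Equiv.Perm ℕ, (∀ k, (1 ≤ τ k ∧ τ k ≤ q + 2) ↔ (1 ≤ k ∧ k ≤ q + 2)) ∧
        ∀ k, 1 ≤ k ∧ k ≤ q + 2 →
          desc t (τ k) (q + 2 - τ k) * g * (desc t k (q + 2 - k))⁻¹ ∈ P := by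
    rintro _ (⟨i, ⟨hi, him⟩, rfl⟩ | ⟨j, ⟨hj, hjq⟩, rfl⟩)
    · refine ⟨1, fun k => Iff.rfl, fun k hk => ?_⟩
      rw [Equiv.Perm.one_apply]
      rcases Nat.lt_or_ge 1 k with h1 | h1
      · have hc : Commute (y i) (desc t k (q + 2 - k)) := commute_desc fun j h2 h3 =>
          h.comm i j hi him (by omega) (by omega)
        rw [← hc.eq, mul_inv_cancel_right]
        exact hyP i hi him
      · obtain rfl : k = 1 := by omega
        exact hF (conj_mem_lastSubgroup hi him)
    · refine ⟨Equiv.swap j (j + 1), fun k => ?_, fun k hk => ?_⟩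
      · rcases eq_or_ne k j with rfl | h1
        · rw [Equiv.swap_apply_left]; omega
        rcases eq_or_ne k (j + 1) with rfl | h2
        · rw [Equiv.swap_apply_right]; omega
        rw [Equiv.swap_apply_of_ne_of_ne h1 h2]
      · have hj1 : desc t j (q + 2 - j) = desc t (j + 1) (q + 2 - (j + 1)) * t j := by
          rw [← desc_succ']; congr 1; omega
        rcases eq_or_ne k j with rfl | h1
        · rw [Equiv.swap_apply_left, hj1, mul_inv_cancel]
          exact P.one_mem
        rcases eq_or_ne k (j + 1) with rfl | h2
        · rw [Equiv.swap_apply_right, hj1, mul_assoc (desc t (j + 1) _), ← pow_two]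
          exact hF (pureGen_mem_lastSubgroup hj (by omega))
        rw [Equiv.swap_apply_of_ne_of_ne h1 h2]
        rcases Nat.lt_or_ge k j with h3 | h3
        · obtain ⟨j, rfl⟩ : ∃ j', j = j' + 1 := ⟨j - 1, by omega⟩
          rw [← h.isBraidSeq.mul_desc hk.1 (by omega) (by omega) (by omega), mul_inv_cancel_right]
          exact htP j (by omega) (by omega)
        · have hc : Commute (t j) (desc t k (q + 2 - k)) := commute_desc fun l h4 h5 =>
            h.isBraidSeq.far j l hj (by omega) (by omega)
          rw [← hc.eq, mul_inv_cancel_right]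
          exact htP j hj (by omega)
  obtain ⟨τ, h1, h2⟩ := exists_perm_coset P (fun k => 1 ≤ k ∧ k ≤ q + 2)
    (fun k => desc t k (q + 2 - k)) hgen hg
  have hR := (h1 (q + 2)).2 ⟨by omega, le_rfl⟩
  have h3 := h2 (q + 2) ⟨by omega, le_rfl⟩
  rw [Nat.sub_self, desc, inv_one, mul_one, ← SetLike.mem_coe, hP,
    Subgroup.coe_mul_of_right_le_normalizer_left _ _ h.mixedSubgroup_le_normalizer] at h3
  obtain ⟨f, hf, x, hx, e⟩ := h3
  exact ⟨_, _, hR.1, by omega, f, hf, x, hx, eq_inv_mul_of_mul_eq e.symm⟩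

end IsMixedSeq

/-- The relators of the irredundant presentation with `q + 1` moving strands, over an explicit sum
type. -/
def mixedRels (m q : ℕ) : Set (FreeGroup ({i : ℕ // 1 ≤ i ∧ i ≤ m} ⊕ {k : ℕ // 1 ≤ k ∧ k ≤ q})) :=
  irrRels m (q + 1)

/-- The group of the irredundant presentation, with `q + 1` moving strands. -/
abbrev MixedBraid (m q : ℕ) : Type := PresentedGroup (mixedRels m q)

namespace MixedBraid

/-- The generator `y_i` of `MixedBraid m q`, for `1 ≤ i ≤ m`. -/
def y (m q i : ℕ) : MixedBraid m q :=
  if h : 1 ≤ i ∧ i ≤ m then PresentedGroup.of (Sum.inl ⟨i, h⟩) else 1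

/-- The generator `t_k` of `MixedBraid m q`, for `1 ≤ k ≤ q`. -/
def t (m q k : ℕ) : MixedBraid m q :=
  if h : 1 ≤ k ∧ k ≤ q then PresentedGroup.of (Sum.inr ⟨k, h⟩) else 1

theorem y_eq {m q i : ℕ} (h1 : 1 ≤ i) (h2 : i ≤ m) :
    y m q i = PresentedGroup.of (Sum.inl ⟨i, h1, h2⟩) := dif_pos ⟨h1, h2⟩

theorem t_eq {m q k : ℕ} (h1 : 1 ≤ k) (h2 : k ≤ q) :
    t m q k = PresentedGroup.of (Sum.inr ⟨k, h1, h2⟩) := dif_pos ⟨h1, h2⟩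

theorem isMixedSeq (m q : ℕ) : IsMixedSeq m q (y m q) (t m q) where
  isBraidSeq :=
    { far := fun k l h1 h2 h3 => by
        rw [t_eq h1 (by omega), t_eq (by omega) h3]
        refine PresentedGroup.mk_eq_mk_of_mul_inv_mem ?_
        refine Or.inl (Or.inl (Or.inl (Or.inl ⟨⟨k, h1, by omega⟩, ⟨l, by omega, h3⟩,
          Or.inl h2, ?_⟩)))
        exact (congrArg _ (mul_inv_rev _ _)).trans (mul_assoc _ _ _).symm
      braid := fun k h1 h2 => by
        rw [t_eq h1 (by omega), t_eq (by omega) h2]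
        exact PresentedGroup.mk_eq_mk_of_mul_inv_mem
          (Or.inl (Or.inl (Or.inl (Or.inr ⟨k, ⟨h1, h2⟩, rfl⟩)))) }
  comm i k h1 h2 h3 h4 := by
    rw [y_eq h1 h2, t_eq (by omega) h4]
    exact PresentedGroup.mk_eq_mk_of_mul_inv_mem
      (Or.inl (Or.inl (Or.inr ⟨i, k, ⟨h1, h2, h3, h4⟩, rfl⟩)))
  four i h1 h2 h3 := by
    rw [y_eq h1 h2, t_eq le_rfl h3]
    exact PresentedGroup.mk_eq_mk_of_mul_inv_mem (Or.inl (Or.inr ⟨i, ⟨h1, h2, h3⟩, rfl⟩))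
  nest i r h1 h2 h3 h4 := by
    rw [y_eq (by omega) h3, y_eq h1 (by omega), t_eq le_rfl h4]
    exact PresentedGroup.mk_eq_mk_of_mul_inv_mem (Or.inr ⟨i, r, ⟨h1, h2, h3, h4⟩, rfl⟩)

variable {m q : ℕ}

/-- The homomorphism out of `MixedBraid m q` given by sequences satisfying its relations. -/
def lift {y t : ℕ → H} (h : IsMixedSeq m q y t) : MixedBraid m q →* H :=
  PresentedGroup.toGroup (f := Sum.elim (fun i => y i.1) fun k => t k.1) (by
    set F := FreeGroup.lift (Sum.elim (fun i : {i : ℕ // 1 ≤ i ∧ i ≤ m} => y i.1)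
      fun k : {k : ℕ // 1 ≤ k ∧ k ≤ q} => t k.1) with hF
    have hY : ∀ i hi, F (of (Sum.inl ⟨i, hi⟩)) = y i := fun _ _ => FreeGroup.lift_apply_of
    have hT : ∀ k hk, F (of (Sum.inr ⟨k, hk⟩)) = t k := fun _ _ => FreeGroup.lift_apply_of
    rintro _ ((((⟨⟨k, hk⟩, ⟨l, hl⟩, hkl, rfl⟩ | ⟨k, hk, rfl⟩) | ⟨i, k, hik, rfl⟩) | ⟨i, hi, rfl⟩) |
      ⟨i, r, hir, rfl⟩)
    · change F (of (Sum.inr ⟨k, _⟩) * of (Sum.inr ⟨l, _⟩) * (of (Sum.inr ⟨k, _⟩))⁻¹ *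
        (of (Sum.inr ⟨l, _⟩))⁻¹) = 1
      have hc : Commute (t k) (t l) := by
        rcases hkl with hkl | hkl
        · exact h.isBraidSeq.far _ _ hk.1 hkl hl.2
        · exact (h.isBraidSeq.far _ _ hl.1 hkl hk.2).symm
      simp only [_root_.map_mul, _root_.map_inv, hT]
      rw [hc.eq, mul_inv_cancel_right, mul_inv_cancel]
    · change F (of (Sum.inr ⟨k, _⟩) * of (Sum.inr ⟨k + 1, _⟩) * of (Sum.inr ⟨k, _⟩) *
        (of (Sum.inr ⟨k + 1, _⟩) * of (Sum.inr ⟨k, _⟩) * of (Sum.inr ⟨k + 1, _⟩))⁻¹) = 1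
      simpa only [_root_.map_mul, _root_.map_inv, hT, mul_inv_eq_one] using
        h.isBraidSeq.braid k hk.1 hk.2
    · change F (of (Sum.inl ⟨i, _⟩) * of (Sum.inr ⟨k, _⟩) *
        (of (Sum.inr ⟨k, _⟩) * of (Sum.inl ⟨i, _⟩))⁻¹) = 1
      simp only [_root_.map_mul, _root_.map_inv, hT, hY, mul_inv_eq_one]
      exact h.comm i k hik.1 hik.2.1 hik.2.2.1 hik.2.2.2
    · change F (of (Sum.inl ⟨i, _⟩) * of (Sum.inr ⟨1, _⟩) * of (Sum.inl ⟨i, _⟩) *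
        of (Sum.inr ⟨1, _⟩) * (of (Sum.inr ⟨1, _⟩) * of (Sum.inl ⟨i, _⟩) * of (Sum.inr ⟨1, _⟩) *
          of (Sum.inl ⟨i, _⟩))⁻¹) = 1
      simp only [_root_.map_mul, _root_.map_inv, hT, hY, mul_inv_eq_one]
      exact h.four i hi.1 hi.2.1 hi.2.2
    · change F (of (Sum.inl ⟨i, _⟩) * (of (Sum.inr ⟨1, _⟩) * of (Sum.inl ⟨r, _⟩) *
        (of (Sum.inr ⟨1, _⟩))⁻¹) * (of (Sum.inr ⟨1, _⟩) * of (Sum.inl ⟨r, _⟩) *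
          (of (Sum.inr ⟨1, _⟩))⁻¹ * of (Sum.inl ⟨i, _⟩))⁻¹) = 1
      simp only [_root_.map_mul, _root_.map_inv, hT, hY, mul_inv_eq_one]
      exact h.nest i r hir.1 hir.2.1 hir.2.2.1 hir.2.2.2)

section lift

variable {y' t' : ℕ → H} (h : IsMixedSeq m q y' t')

theorem lift_of_inl (i : {i : ℕ // 1 ≤ i ∧ i ≤ m}) :
    lift h (PresentedGroup.of (Sum.inl i)) = y' i.1 := PresentedGroup.toGroup.of _

theorem lift_of_inr (k : {k : ℕ // 1 ≤ k ∧ k ≤ q}) :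
    lift h (PresentedGroup.of (Sum.inr k)) = t' k.1 := PresentedGroup.toGroup.of _

theorem lift_y {i : ℕ} (h1 : 1 ≤ i) (h2 : i ≤ m) : lift h (y m q i) = y' i := by
  rw [y_eq h1 h2, lift_of_inl]

theorem lift_t {k : ℕ} (h1 : 1 ≤ k) (h2 : k ≤ q) : lift h (t m q k) = t' k := by
  rw [t_eq h1 h2]
  exact lift_of_inr h ⟨k, h1, h2⟩

end lift

theorem mixedSubgroup_eq_top (m q : ℕ) : mixedSubgroup m q (y m q) (t m q) = ⊤ := by
  rw [eq_top_iff, ← PresentedGroup.closure_range_of, Subgroup.closure_le]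
  rintro _ ⟨i | k, rfl⟩
  · exact Subgroup.subset_closure (Or.inl ⟨i.1, i.2, y_eq i.2.1 i.2.2⟩)
  · exact Subgroup.subset_closure (Or.inr ⟨k.1, k.2, t_eq k.2.1 k.2.2⟩)

theorem hom_ext {f g : MixedBraid m q →* H} (hy : ∀ i, 1 ≤ i → i ≤ m → f (y m q i) = g (y m q i))
    (ht : ∀ k, 1 ≤ k → k ≤ q → f (t m q k) = g (t m q k)) : f = g := by
  refine PresentedGroup.ext ?_
  rintro (i | k)
  · rw [← y_eq i.2.1 i.2.2, hy _ i.2.1 i.2.2]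
  · have := ht k.1 k.2.1 k.2.2
    rwa [t_eq k.2.1 k.2.2] at this

theorem range_le {f : MixedBraid m q →* H} {P : Subgroup H}
    (hy : ∀ i, 1 ≤ i → i ≤ m → f (y m q i) ∈ P) (ht : ∀ k, 1 ≤ k → k ≤ q → f (t m q k) ∈ P) :
    f.range ≤ P := by
  rw [MonoidHom.range_eq_map, ← mixedSubgroup_eq_top, mixedSubgroup, MonoidHom.map_closure,
    Subgroup.closure_le]
  rintro _ ⟨_, ⟨i, hi, rfl⟩ | ⟨k, hk, rfl⟩, rfl⟩
  · exact hy i hi.1 hi.2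
  · exact ht k hk.1 hk.2

/-- The inclusion of `MixedBraid m q` in `MixedBraid m (q + 1)`. -/
def incl (m q : ℕ) : MixedBraid m q →* MixedBraid m (q + 1) := lift (isMixedSeq m (q + 1)).mono

theorem mixedSubgroup_le_range_incl :
    mixedSubgroup m q (y m (q + 1)) (t m (q + 1)) ≤ (incl m q).range := by
  rw [mixedSubgroup, Subgroup.closure_le]
  rintro _ (⟨i, hi, rfl⟩ | ⟨k, hk, rfl⟩)
  · exact ⟨_, lift_y _ hi.1 hi.2⟩
  · exact ⟨_, lift_t _ hk.1 hk.2⟩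

open InfBraid

/-- The homomorphism from `MixedBraid m q` to the infinite braid group. -/
def toInf (m q : ℕ) : MixedBraid m q →* InfBraid := lift (isBraidSeq_σ (m + q)).isMixedSeq

theorem toInf_y {i : ℕ} (h1 : 1 ≤ i) (h2 : i ≤ m) : toInf m q (y m q i) = pureGen σ i (m - i) :=
  lift_y _ h1 h2

theorem toInf_t {k : ℕ} (h1 : 1 ≤ k) (h2 : k ≤ q) : toInf m q (t m q k) = σ (m + k) :=
  lift_t _ h1 h2

theorem toInf_desc {k l : ℕ} (h1 : 1 ≤ k) (h2 : k + l ≤ q + 1) :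
    toInf m q (desc (t m q) k l) = desc σ (m + k) l := by
  rw [map_desc, ← desc_shift]
  exact desc_congr fun j h3 h4 => toInf_t (by omega) (by omega)

theorem toInf_pureGen {k l : ℕ} (h1 : 1 ≤ k) (h2 : k + l ≤ q) :
    toInf m q (pureGen (t m q) k l) = pureGen σ (m + k) l := by
  rw [pureGen, pureGen, _root_.map_mul, _root_.map_mul, _root_.map_inv, _root_.map_pow,
    toInf_desc (by omega) (by omega), toInf_t h1 (by omega), add_assoc]

theorem toInf_incl (x : MixedBraid m q) : toInf m (q + 1) (incl m q x) = toInf m q x := by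
  refine DFunLike.congr_fun (f := (toInf m (q + 1)).comp (incl m q)) (hom_ext ?_ ?_) x
  · intro i h1 h2
    rw [MonoidHom.comp_apply, incl, lift_y _ h1 h2, toInf_y h1 h2, toInf_y h1 h2]
  · intro k h1 h2
    rw [MonoidHom.comp_apply, incl, lift_t _ h1 h2, toInf_t h1 (by omega), toInf_t h1 h2]

theorem toInf_mem_fixing (x : MixedBraid m q) : toInf m q x ∈ fixing (m + q + 2) := by
  refine range_le (fun i h1 h2 => ?_) (fun k h1 h2 => ?_) ⟨x, rfl⟩
  · rw [toInf_y h1 h2]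
    exact pureGen_mem fun k h3 h4 => σ_mem_fixing (by omega)
  · rw [toInf_t h1 h2]
    exact σ_mem_fixing (by omega)

theorem toInf_lastGen {i : ℕ} (h1 : 1 ≤ i) (h2 : i ≤ m + q + 1) :
    toInf m (q + 1) (lastGen m q (y m (q + 1)) (t m (q + 1)) i) = pureGen σ i (m + q + 1 - i) := by
  rw [lastGen]
  split_ifs with h
  · rw [show m + q + 1 - i = m - i + (q + 1) by omega, pureGen_add, _root_.map_mul,
      _root_.map_mul, _root_.map_inv, toInf_desc le_rfl (by omega), toInf_y h1 h,
      show i + 1 + (m - i) = m + 1 by omega]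
  · rw [toInf_pureGen (by omega) (by omega), show m + (i - m) = i by omega]

theorem strandRep_toInf_lastGen {i : ℕ} (h1 : 1 ≤ i) (h2 : i ≤ m + q + 1) (p : FreeBraid) :
    strandRep (toInf m (q + 1) (lastGen m q (y m (q + 1)) (t m (q + 1)) i)) (m + q + 2, p) =
      (m + q + 2, fx i * p) := by
  have h := strandRep_pureGen i (m + q + 1 - i) p
  rwa [show i + 1 + (m + q + 1 - i) = m + q + 2 by omega, ← toInf_lastGen h1 h2] at h

open SemidirectProduct in
/-- A subgroup acting on a strand as free generators is parametrized by a free group. -/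
theorem exists_lift_eq {G : Type*} [Group G] (Φ : G →* InfBraid) (ψ : ℕ → G) {N : ℕ} {I : Set ℕ}
    (hI : ∀ i ∈ I, ∀ p, strandRep (Φ (ψ i)) (N, p) = (N, fx i * p)) {f : G}
    (hf : f ∈ Subgroup.closure (ψ '' I)) :
    ∃ w : FreeGroup ℕ, FreeGroup.lift ψ w = f ∧
      ∀ p, strandRep (Φ f) (N, p) = (N, (inl w : FreeBraid) * p) := by
  induction hf using Subgroup.closure_induction with
  | mem f hf =>
    obtain ⟨i, hi, rfl⟩ := hf
    exact ⟨of i, FreeGroup.lift_apply_of, hI i hi⟩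
  | one => exact ⟨1, _root_.map_one _, by simp⟩
  | mul f g _ _ ihf ihg =>
    obtain ⟨v, rfl, hv⟩ := ihf
    obtain ⟨w, rfl, hw⟩ := ihg
    refine ⟨v * w, _root_.map_mul .., fun p => ?_⟩
    rw [_root_.map_mul, _root_.map_mul, Equiv.Perm.mul_apply, hw, hv, _root_.map_mul, mul_assoc]
  | inv f _ ihf =>
    obtain ⟨w, rfl, hw⟩ := ihf
    refine ⟨w⁻¹, _root_.map_inv .., fun p => ?_⟩
    rw [_root_.map_inv, _root_.map_inv, Equiv.Perm.inv_eq_iff_eq, hw, _root_.map_inv,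
      mul_inv_cancel_left]

open SemidirectProduct in
theorem toInf_injective (m q : ℕ) : Function.Injective (toInf m q) := by
  induction q with
  | zero =>
    refine (injective_iff_map_eq_one _).2 fun g hg => ?_
    have hmem : g ∈ Subgroup.closure (y m 0 '' Set.Icc 1 m) := by
      have : g ∈ mixedSubgroup m 0 (y m 0) (t m 0) := by
        rw [mixedSubgroup_eq_top]; trivial
      rwa [mixedSubgroup, Set.Icc_eq_empty (show ¬1 ≤ 0 by omega), Set.image_empty,
        Set.union_empty] at this
    obtain ⟨w, rfl, hw⟩ := exists_lift_eq (toInf m 0) (y m 0) (N := m + 1) (fun i hi p => by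
      have h := strandRep_pureGen i (m - i) p
      rwa [show i + 1 + (m - i) = m + 1 by have := hi.2; omega, ← toInf_y hi.1 hi.2] at h) hmem
    have h1 := (hw 1).symm
    rw [hg, _root_.map_one, Equiv.Perm.one_apply, mul_one, Prod.mk.injEq,
      ← _root_.map_one (inl : FreeGroup ℕ →* FreeBraid), inl_inj] at h1
    rw [h1.2, _root_.map_one]
  | succ q ih =>
    refine (injective_iff_map_eq_one _).2 fun g hg => ?_
    obtain ⟨k, l, hk, hkl, f, hf, x, hx, rfl⟩ := (isMixedSeq m (q + 1)).exists_eq_mul (g := g) (by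
      rw [mixedSubgroup_eq_top]; trivial)
    obtain ⟨x, rfl⟩ := mixedSubgroup_le_range_incl hx
    set ψ := lastGen m q (y m (q + 1)) (t m (q + 1))
    obtain ⟨w, rfl, hw⟩ := exists_lift_eq (toInf m (q + 1)) ψ
      (fun i hi p => strandRep_toInf_lastGen hi.1 hi.2 p) hf
    have hact : ∀ p, strandRep (toInf m (q + 1) (FreeGroup.lift ψ w * incl m q x)) (m + q + 2, p) =
        (m + q + 2, (inl w : FreeBraid) * (inr (toInf m q x) * p)) := fun p => by
      rw [_root_.map_mul, _root_.map_mul, Equiv.Perm.mul_apply, toInf_incl, toInf_mem_fixing x,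
        hw]
    have hd : toInf m (q + 1) (FreeGroup.lift ψ w * incl m q x) = desc σ (m + k) l := by
      rwa [_root_.map_mul, _root_.map_inv, inv_mul_eq_one, toInf_desc hk (by omega), eq_comm] at hg
    have h1 := hact 1
    rw [hd, mul_one, ← show m + k + l = m + q + 2 by omega, ← strandRep_desc _ _ (_ * _),
      (strandRep (desc σ (m + k) l)).injective.eq_iff, Prod.mk.injEq] at h1
    obtain ⟨h2, h3⟩ := h1
    obtain rfl : l = 0 := by omega
    have hx1 : toInf m q x = 1 := by
      simpa using congrArg SemidirectProduct.right h3.symm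
    have hw1 : w = 1 := by
      simpa [hx1] using congrArg SemidirectProduct.left h3.symm
    rw [hw1, (injective_iff_map_eq_one _).1 ih x hx1]
    simp [desc]

end MixedBraid

/-- The homomorphism out of `BraidGroup n` given by a sequence satisfying the braid relations. -/
def braidLift {n : ℕ} {s : ℕ → H} (hs : IsBraidSeq n s) : BraidGroup n →* H :=
  PresentedGroup.toGroup (f := fun k : Fin n => s (k + 1)) (by
    rintro _ (⟨k, l, hkl, rfl⟩ | ⟨k, l, hkl, rfl⟩)
    · have hc : Commute (s (k + 1)) (s (l + 1)) := by
        rcases hkl with hkl | hkl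
        · exact hs.far _ _ (by omega) (by omega) (by omega)
        · exact (hs.far _ _ (by omega) (by omega) (by omega)).symm
      simp only [_root_.map_mul, _root_.map_inv, FreeGroup.lift_apply_of]
      rw [hc.eq, mul_inv_cancel_right, mul_inv_cancel]
    · have hb := hs.braid (k + 1) (by omega) (by omega)
      simp only [_root_.map_mul, _root_.map_inv, FreeGroup.lift_apply_of, hkl]
      rw [hb]
      group)

theorem sgen_eq {n k : ℕ} (h1 : 1 ≤ k) (h2 : k ≤ n) :
    sgen n k = PresentedGroup.of ⟨k - 1, by omega⟩ := dif_pos ⟨h1, h2⟩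

theorem braidLift_sgen {n : ℕ} {s : ℕ → H} (hs : IsBraidSeq n s) {k : ℕ} (h1 : 1 ≤ k)
    (h2 : k ≤ n) : braidLift hs (sgen n k) = s k := by
  rw [sgen_eq h1 h2, braidLift, PresentedGroup.toGroup.of]
  simp only [Nat.sub_add_cancel h1]

theorem isBraidSeq_sgen (n : ℕ) : IsBraidSeq n (sgen n) where
  far k l h1 h2 h3 := by
    rw [sgen_eq h1 (by omega), sgen_eq (by omega) h3]
    refine PresentedGroup.mk_eq_mk_of_mul_inv_mem ?_
    refine Or.inl ⟨⟨k - 1, by omega⟩, ⟨l - 1, by omega⟩, Or.inl (by simp only; omega), ?_⟩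
    exact (congrArg _ (mul_inv_rev _ _)).trans (mul_assoc _ _ _).symm
  braid k h1 h2 := by
    rw [sgen_eq h1 (by omega), sgen_eq (by omega) h2]
    refine PresentedGroup.mk_eq_mk_of_mul_inv_mem ?_
    refine Or.inr ⟨⟨k - 1, by omega⟩, ⟨k + 1 - 1, by omega⟩, by simp only; omega, ?_⟩
    simp only [mul_inv_rev, mul_assoc]

theorem dprod_eq_desc (n i l : ℕ) : dprod n i (i + 1 + l) = desc (sgen n) (i + 1) l := by
  have h : ∀ l c, ((List.range l).map fun t => sgen n (c + l - 1 - t)).prod =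
      desc (sgen n) c l := by
    intro l
    induction l with
    | zero => intro c; rfl
    | succ l ih =>
      intro c
      rw [List.range_succ_eq_map, List.map_cons, List.prod_cons, List.map_map, desc, ← ih c]
      congr 3
      · funext t
        exact congrArg (sgen n) (by omega)
  rw [dprod, ← h, show i + 1 + l - 1 - i = l by omega]

theorem agen_eq_pureGen (n i l : ℕ) : agen n i (i + 1 + l) = pureGen (sgen n) i l := by
  rw [agen, dprod_eq_desc, pureGen]

namespace MixedBraid

/-- The homomorphism `y_i ↦ a_{i,m+1}`, `t_k ↦ σ_{m+k}`. -/
def toBraid (m q : ℕ) : MixedBraid m q →* BraidGroup (m + q) :=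
  lift (isBraidSeq_sgen (m + q)).isMixedSeq

theorem toBraid_y {m q i : ℕ} (h1 : 1 ≤ i) (h2 : i ≤ m) :
    toBraid m q (y m q i) = agen (m + q) i (m + 1) := by
  rw [toBraid, lift_y _ h1 h2, ← agen_eq_pureGen, show i + 1 + (m - i) = m + 1 by omega]

theorem toBraid_t {m q k : ℕ} (h1 : 1 ≤ k) (h2 : k ≤ q) :
    toBraid m q (t m q k) = sgen (m + q) (m + k) := lift_t _ h1 h2

theorem toBraid_injective (m q : ℕ) : Function.Injective (toBraid m q) := by
  let f : BraidGroup (m + q) →* InfBraid := braidLift (InfBraid.isBraidSeq_σ (m + q))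
  have hf : ∀ k, 1 ≤ k → k ≤ m + q → f (sgen (m + q) k) = InfBraid.σ k := fun k h1 h2 =>
    braidLift_sgen _ h1 h2
  have h : f.comp (toBraid m q) = toInf m q := by
    refine hom_ext (fun i h1 h2 => ?_) fun k h1 h2 => ?_
    · rw [MonoidHom.comp_apply, toBraid, lift_y _ h1 h2, toInf_y h1 h2, map_pureGen]
      exact pureGen_congr fun k h3 h4 => hf k (by omega) (by omega)
    · rw [MonoidHom.comp_apply, toBraid_t h1 h2, toInf_t h1 h2, hf _ (by omega) (by omega)]
  have hi := toInf_injective m q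
  rw [← h, MonoidHom.coe_comp] at hi
  exact hi.of_comp

theorem range_toBraid (m q : ℕ) : (toBraid m q).range = Bmn m (q + 1) := by
  have ht : ∀ k, m + 1 ≤ k → k ≤ m + q → sgen (m + q) k ∈ (toBraid m q).range := fun k h1 h2 =>
    ⟨t m q (k - m), by rw [toBraid_t (by omega) (by omega), show m + (k - m) = k by omega]⟩
  apply le_antisymm
  · refine range_le (fun i h1 h2 => ?_) fun k h1 h2 => ?_
    · rw [toBraid_y h1 h2]
      exact Subgroup.subset_closure (Or.inl ⟨i, m + 1, h1, by omega, le_rfl, by omega, rfl⟩)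
    · rw [toBraid_t h1 h2]
      exact Subgroup.subset_closure (Or.inr ⟨m + k, by omega, by omega, rfl⟩)
  · rw [Bmn, Subgroup.closure_le]
    rintro _ (⟨i, j, h1, h2, h3, h4, rfl⟩ | ⟨k, h1, h2, rfl⟩)
    · change agen (m + q) i j ∈ (toBraid m q).range
      obtain ⟨l, rfl⟩ : ∃ l, j = i + 1 + l := ⟨j - (i + 1), by omega⟩
      rw [agen_eq_pureGen]
      rcases Nat.lt_or_ge m i with h | h
      · exact pureGen_mem fun k h5 h6 => ht k (by omega) (by omega)
      · rw [show l = m - i + (i + l - m) by omega, pureGen_add]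
        have hd : desc (sgen (m + q)) (i + 1 + (m - i)) (i + l - m) ∈ (toBraid m q).range :=
          desc_mem fun k h5 h6 => ht k (by omega) (by omega)
        refine mul_mem (mul_mem hd ⟨y m q i, ?_⟩) (inv_mem hd)
        rw [toBraid, lift_y _ h1 h]
    · exact ht k h1 h2

end MixedBraid

end

/-- Theorem 3 (irredundant presentation): the group presented by the generators
`y_1, …, y_m, t_1, …, t_{n−1}` and the relations above is isomorphic to `B_{m,n}`,
via `y_i ↦ a_{i,m+1}` and `t_k ↦ σ_{m+k}`. -/
theorem statement17 (m n : ℕ) (hm : 1 ≤ m) (hn : 1 ≤ n) :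
    ∃ φ : PresentedGroup (irrRels m n) ≃* ↥(Bmn m n),
      (∀ i : {i : ℕ // 1 ≤ i ∧ i ≤ m},
        (φ (PresentedGroup.of (Sum.inl i)) : BraidGroup (m + n - 1)) =
          agen (m + n - 1) i.1 (m + 1)) ∧
      (∀ k : {k : ℕ // 1 ≤ k ∧ k ≤ n - 1},
        (φ (PresentedGroup.of (Sum.inr k)) : BraidGroup (m + n - 1)) =
          sgen (m + n - 1) (m + k.1)) := by
  obtain ⟨q, rfl⟩ : ∃ q, n = q + 1 := ⟨n - 1, by omega⟩
  refine ⟨(MonoidHom.ofInjective (MixedBraid.toBraid_injective m q)).trans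
    (MulEquiv.subgroupCongr (MixedBraid.range_toBraid m q)), fun i => ?_, fun k => ?_⟩
  · exact (congrArg (MixedBraid.toBraid m q) (MixedBraid.y_eq i.2.1 i.2.2).symm).trans
      (MixedBraid.toBraid_y i.2.1 i.2.2)
  · exact (congrArg (MixedBraid.toBraid m q) (MixedBraid.t_eq k.2.1 k.2.2).symm).trans
      (MixedBraid.toBraid_t k.2.1 k.2.2)

end BraidPaper
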